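/- arXiv:1711.00572 — 4 statements merged into one kernel-verified Lean document; each statement's English description precedes it below -/
import Mathlib

section
/- Let x, y : ℕ → [0, ∞) be nonincreasing (antitone) sequences with ∑_{m=0}^∞ x_m² < ∞ and ∑_{m=0}^∞ y_m² < ∞. Then for every bijection ζ : ℕ → ℕ, ∑_{m=0}^∞ (x_m − y_m)² ≤ ∑_{m=0}^∞ (x_m − y_{ζ(m)})². -/
theorem Antitone.sum_le_sum_range_card {y : ℕ → ℝ} (hy : Antitone y) (s : Finset ℕ) :
    ∑ k ∈ s, y k ≤ ∑ k ∈ Finset.range s.card, y k := by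
  induction s using Finset.induction_on_max with
  | empty => simp
  | insert a s h ih =>
    have ha : a ∉ s := fun h' => (h a h').false
    rw [Finset.sum_insert ha, Finset.card_insert_of_notMem ha, Finset.sum_range_succ, add_comm]
    have hcard : s.card ≤ a := by
      simpa using Finset.card_le_card (fun k hk => Finset.mem_range.2 (h k hk) :
        s ⊆ Finset.range a)
    exact add_le_add ih (hy hcard)

theorem Antitone.sum_range_mul_nonpos {x d : ℕ → ℝ} (hx : Antitone x) (hx0 : ∀ m, 0 ≤ x m)
    (hd : ∀ n, ∑ m ∈ Finset.range n, d m ≤ 0) (n : ℕ) :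
    ∑ m ∈ Finset.range n, x m * d m ≤ 0 := by
  have key : ∑ m ∈ Finset.range n, x m * d m ≤ x n * ∑ m ∈ Finset.range n, d m := by
    induction n with
    | zero => simp
    | succ n ih =>
      have h := mul_le_mul_of_nonpos_right (hx n.le_succ) (hd (n + 1))
      rw [Finset.sum_range_succ]
      rw [Finset.sum_range_succ d n] at h ⊢
      linarith
  exact key.trans (mul_nonpos_of_nonneg_of_nonpos (hx0 n) (hd n))

theorem Summable.mul_of_sq {ι : Type*} {f g : ι → ℝ} (hf : Summable fun i => f i ^ 2)
    (hg : Summable fun i => g i ^ 2) : Summable fun i => f i * g i :=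
  (hf.add hg).of_norm_bounded fun i => by
    rw [Real.norm_eq_abs, abs_le]
    constructor <;> nlinarith [sq_nonneg (f i + g i), sq_nonneg (f i - g i)]

/-- Rearrangement inequality underlying `δ₂(x,y) = ‖x^↓ − y^↓‖_{ℓ₂}`: for nonincreasing
nonnegative square-summable sequences, the identity permutation minimizes
`∑ₘ (xₘ − y_{ζ(m)})²` over all bijections `ζ` of `ℕ`. -/
theorem stmt_3 (x y : ℕ → ℝ) (hx_nonneg : ∀ m, 0 ≤ x m) (hy_nonneg : ∀ m, 0 ≤ y m)
    (hx_anti : Antitone x) (hy_anti : Antitone y)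
    (hx_sq : Summable fun m => (x m) ^ 2) (hy_sq : Summable fun m => (y m) ^ 2)
    (e : ℕ ≃ ℕ) :
    ∑' m, (x m - y m) ^ 2 ≤ ∑' m, (x m - y (e m)) ^ 2 := by
  have hye_sq : Summable fun m => y (e m) ^ 2 := e.summable_iff.2 hy_sq
  have hxy := hx_sq.mul_of_sq hy_sq
  have hxye := hx_sq.mul_of_sq hye_sq
  have hpartial : ∀ n, ∑ m ∈ Finset.range n, (y (e m) - y m) ≤ 0 := fun n => by
    have h := hy_anti.sum_le_sum_range_card ((Finset.range n).map e.toEmbedding)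
    simp only [Finset.sum_map, Finset.card_map, Finset.card_range, Equiv.coe_toEmbedding] at h
    rw [Finset.sum_sub_distrib]
    linarith
  have hmul : ∑' m, x m * y (e m) ≤ ∑' m, x m * y m :=
    le_of_tendsto_of_tendsto' hxye.hasSum.tendsto_sum_nat hxy.hasSum.tendsto_sum_nat fun n => by
      have h := hx_anti.sum_range_mul_nonpos hx_nonneg hpartial n
      simp only [mul_sub, Finset.sum_sub_distrib] at h
      linarith
  have expand : ∀ z : ℕ → ℝ, Summable (fun m => z m ^ 2) → Summable (fun m => x m * z m) →
      ∑' m, (x m - z m) ^ 2 = ∑' m, x m ^ 2 + ∑' m, z m ^ 2 - 2 * ∑' m, x m * z m := by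
    intro z hz hxz
    rw [← hx_sq.tsum_add hz, ← tsum_mul_left, ← (hx_sq.add hz).tsum_sub (hxz.mul_left 2)]
    exact tsum_congr fun m => by ring
  rw [expand y hy_sq hxy, expand (fun m => y (e m)) hye_sq hxye,
    e.tsum_eq fun m => y m ^ 2]
  linarith
end

section
/- Let U be a real n × p matrix, let B be a p × p symmetric positive definite real matrix, and let w ∈ ℝⁿ with w_i ≥ 0 for all i. Then det(Uᵀ diag(w₁,…,wₙ) U + B⁻¹) ≤ det(UᵀU + B⁻¹) · (∑_{i=1}^n w_i + 1)^p. -/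
open Matrix

open scoped MatrixOrder in
theorem Matrix.PosDef.exists_isUnit_eq_conjTranspose_mul_self {ι : Type*} [Fintype ι]
    [DecidableEq ι] {A : Matrix ι ι ℝ} (hA : A.PosDef) :
    ∃ M : Matrix ι ι ℝ, IsUnit M ∧ A = Mᴴ * M := by
  obtain ⟨M, hM, h⟩ := CStarAlgebra.isStrictlyPositive_iff_eq_star_mul_self.mp hA.isStrictlyPositive
  exact ⟨M, hM, h⟩

theorem Matrix.PosSemidef.one_le_det_one_add {ι : Type*} [Fintype ι] [DecidableEq ι]
    {P : Matrix ι ι ℝ} (hP : P.PosSemidef) : 1 ≤ (1 + P).det := by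
  have hN : (-P).IsHermitian := hP.1.neg
  have h : (1 + P).det = ∏ i, (1 - hN.eigenvalues i) := by
    have := (-P).eval_charpoly 1
    rw [hN.charpoly_eq, Polynomial.eval_prod] at this
    simpa using this.symm
  rw [h]
  refine Finset.one_le_prod fun i _ => ?_
  have hi := hN.eigenvalues_eq i
  have := hP.dotProduct_mulVec_nonneg (hN.eigenvectorBasis i)
  rw [neg_mulVec, dotProduct_neg, RCLike.re_to_real] at hi
  linarith

theorem Matrix.PosDef.det_le_det_add {ι : Type*} [Fintype ι] [DecidableEq ι]
    {A C : Matrix ι ι ℝ} (hA : A.PosDef) (hC : C.PosSemidef) : A.det ≤ (A + C).det := by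
  obtain ⟨M, hM, hAM⟩ := hA.exists_isUnit_eq_conjTranspose_mul_self
  have hdet := (M.isUnit_iff_isUnit_det).mp hM
  have hP := hC.conjTranspose_mul_mul_same M⁻¹
  have hfactor : A + C = Mᴴ * (1 + (M⁻¹)ᴴ * C * M⁻¹) * M := by
    have hl : Mᴴ * (M⁻¹)ᴴ = 1 := by
      rw [← conjTranspose_mul, nonsing_inv_mul _ hdet, conjTranspose_one]
    calc
      A + C = Mᴴ * M + (Mᴴ * (M⁻¹)ᴴ) * C * (M⁻¹ * M) := by
        rw [hl, nonsing_inv_mul _ hdet, one_mul, mul_one, hAM]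
      _ = _ := by noncomm_ring
  have hdetA : (A + C).det = A.det * (1 + (M⁻¹)ᴴ * C * M⁻¹).det := by
    rw [hfactor, hAM, det_mul, det_mul, det_mul]
    ring
  rw [hdetA]
  exact le_mul_of_one_le_right hA.det_pos.le hP.one_le_det_one_add

/-- Proposition A.1: determinant bound
`det(Uᵀ diag(w) U + B⁻¹) ≤ det(UᵀU + B⁻¹) (∑ᵢ wᵢ + 1)^p`. -/
theorem stmt_4 {n p : ℕ} (U : Matrix (Fin n) (Fin p) ℝ) (B : Matrix (Fin p) (Fin p) ℝ)
    (hB : B.PosDef) (w : Fin n → ℝ) (hw : ∀ i, 0 ≤ w i) :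
    (Uᵀ * Matrix.diagonal w * U + B⁻¹).det
      ≤ (Uᵀ * U + B⁻¹).det * (∑ i, w i + 1) ^ p := by
  set s := ∑ i, w i + 1
  have hsum : 0 ≤ ∑ i, w i := Finset.sum_nonneg fun i _ => hw i
  have hws : ∀ i, 0 ≤ s - w i := fun i => by
    have := Finset.single_le_sum (fun j _ => hw j) (Finset.mem_univ i)
    grind
  have hpsd {d : Fin n → ℝ} (hd : ∀ i, 0 ≤ d i) : (Uᵀ * diagonal d * U).PosSemidef := by
    simpa using (PosSemidef.diagonal (d := d) hd).conjTranspose_mul_mul_same U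
  have hgap : (Uᵀ * diagonal (fun i => s - w i) * U + (∑ i, w i) • B⁻¹).PosSemidef :=
    (hpsd hws).add (hB.inv.posSemidef.smul hsum)
  have heq : (Uᵀ * diagonal w * U + B⁻¹)
      + (Uᵀ * diagonal (fun i => s - w i) * U + (∑ i, w i) • B⁻¹) = s • (Uᵀ * U + B⁻¹) := by
    have hdiag : diagonal (fun i => s - w i) = s • (1 : Matrix (Fin n) (Fin n) ℝ) - diagonal w := by
      rw [smul_one_eq_diagonal, diagonal_sub]
    have hs : s • B⁻¹ = (∑ i, w i) • B⁻¹ + B⁻¹ := by rw [add_smul, one_smul]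
    rw [hdiag, Matrix.mul_sub, Matrix.sub_mul, smul_add, hs, Matrix.mul_smul, Matrix.smul_mul,
      Matrix.mul_one]
    abel
  have h := (hB.inv.posSemidef_add (hpsd hw)).det_le_det_add hgap
  rw [heq, det_smul, Fintype.card_fin] at h
  rwa [mul_comm]
end

section
/- Under the PS&W setup, there exists a constant C₁ > 0 such that for all w ∈ [0,∞)ⁿ and all β ∈ ℝ^p: (2π)^{−p/2} · det(Uᵀ Ω(w) U + B⁻¹)^{1/2} · exp( −(1/2) (β − Σ(w)μ)ᵀ (Uᵀ Ω(w) U + B⁻¹) (β − Σ(w)μ) ) ≤ C₁ · ( ∑_{i=1}^n w_i + 1 )^{p/2} · exp( −(1/2) βᵀ B⁻¹ β ) · exp( βᵀ μ ). -/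
open Matrix

/-- The precision matrix `UᵀΩ(w)U + B⁻¹` of the conditional Gaussian in the PS&W sampler. -/
noncomputable def pswPrec {n p : ℕ} (U : Matrix (Fin n) (Fin p) ℝ)
    (B : Matrix (Fin p) (Fin p) ℝ) (w : Fin n → ℝ) : Matrix (Fin p) (Fin p) ℝ :=
  Uᵀ * Matrix.diagonal w * U + B⁻¹

/-- The vector `μ = Uᵀ(y − ½1ₙ) + B⁻¹b` in the PS&W setup. -/
noncomputable def pswMu {n p : ℕ} (U : Matrix (Fin n) (Fin p) ℝ)
    (B : Matrix (Fin p) (Fin p) ℝ) (b : Fin p → ℝ) (y : Fin n → ℝ) : Fin p → ℝ :=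
  Uᵀ *ᵥ (fun i => y i - 1/2) + B⁻¹ *ᵥ b

/-- The `N_p(Σ(w)μ, Σ(w))` density `π(β | w, y)` of the PS&W Gibbs sampler, where
`Σ(w) = (UᵀΩ(w)U + B⁻¹)⁻¹`. -/
noncomputable def pswNormalDensity {n p : ℕ} (U : Matrix (Fin n) (Fin p) ℝ)
    (B : Matrix (Fin p) (Fin p) ℝ) (b : Fin p → ℝ) (y : Fin n → ℝ)
    (β : Fin p → ℝ) (w : Fin n → ℝ) : ℝ :=
  (2 * Real.pi) ^ (-(p : ℝ) / 2) * (pswPrec U B w).det ^ ((1 : ℝ) / 2) *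
    Real.exp (-(1/2) * ((β - (pswPrec U B w)⁻¹ *ᵥ pswMu U B b y) ⬝ᵥ
      (pswPrec U B w) *ᵥ (β - (pswPrec U B w)⁻¹ *ᵥ pswMu U B b y)))

theorem pswPrec_posDef {n p : ℕ} (U : Matrix (Fin n) (Fin p) ℝ)
    {B : Matrix (Fin p) (Fin p) ℝ} (hB : B.PosDef) {w : Fin n → ℝ} (hw : ∀ i, 0 ≤ w i) :
    (pswPrec U B w).PosDef := by
  have h : (Uᵀ * Matrix.diagonal w * U).PosSemidef := by
    simpa using (PosSemidef.diagonal hw).conjTranspose_mul_mul_same U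
  exact PosDef.posSemidef_add h hB.inv

/-- The quadratic form of `B⁻¹` is dominated by that of the precision matrix. -/
theorem dotProduct_inv_mulVec_le_pswPrec {n p : ℕ} (U : Matrix (Fin n) (Fin p) ℝ)
    (B : Matrix (Fin p) (Fin p) ℝ) {w : Fin n → ℝ} (hw : ∀ i, 0 ≤ w i) (β : Fin p → ℝ) :
    β ⬝ᵥ B⁻¹ *ᵥ β ≤ β ⬝ᵥ pswPrec U B w *ᵥ β := by
  have h : (Uᵀ * Matrix.diagonal w * U).PosSemidef := by
    simpa using (PosSemidef.diagonal hw).conjTranspose_mul_mul_same U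
  have := h.dotProduct_mulVec_nonneg β
  simp only [star_trivial] at this
  rw [pswPrec, add_mulVec, dotProduct_add]
  linarith

/-- Completing the square, with the nonnegative constant term dropped. -/
theorem Matrix.PosDef.le_quadForm_sub_inv_mulVec {p : ℕ} {P : Matrix (Fin p) (Fin p) ℝ}
    (hP : P.PosDef) (β m : Fin p → ℝ) :
    β ⬝ᵥ P *ᵥ β - 2 * (β ⬝ᵥ m) ≤ (β - P⁻¹ *ᵥ m) ⬝ᵥ P *ᵥ (β - P⁻¹ *ᵥ m) := by
  have hdet : IsUnit P.det := hP.det_pos.ne'.isUnit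
  have hPm : P *ᵥ (P⁻¹ *ᵥ m) = m := by
    rw [mulVec_mulVec, mul_nonsing_inv _ hdet, one_mulVec]
  have hsymm : Pᵀ = P := by simpa using hP.isHermitian.eq
  have hcross : (P⁻¹ *ᵥ m) ⬝ᵥ P *ᵥ β = β ⬝ᵥ m := by
    rw [dotProduct_mulVec, ← mulVec_transpose, hsymm, hPm, dotProduct_comm]
  have hconst := hP.inv.posSemidef.dotProduct_mulVec_nonneg m
  simp only [star_trivial] at hconst
  rw [mulVec_sub, hPm, sub_dotProduct, dotProduct_sub, dotProduct_sub, hcross,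
    dotProduct_comm (P⁻¹ *ᵥ m) m]
  linarith

/-- The entries of the precision matrix grow at most linearly in the total weight. -/
theorem exists_abs_pswPrec_apply_le {n p : ℕ} (U : Matrix (Fin n) (Fin p) ℝ)
    (B : Matrix (Fin p) (Fin p) ℝ) :
    ∃ K > (0 : ℝ), ∀ w : Fin n → ℝ, (∀ i, 0 ≤ w i) → ∀ i j,
      |pswPrec U B w i j| ≤ K * (∑ i, w i + 1) := by
  obtain ⟨a, ha⟩ := Finite.bddAbove_range
    fun t : Fin n × Fin p × Fin p => |U t.1 t.2.1 * U t.1 t.2.2|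
  obtain ⟨c, hc⟩ := Finite.bddAbove_range fun t : Fin p × Fin p => |B⁻¹ t.1 t.2|
  refine ⟨1 + |a| + |c|, by positivity, fun w hw i j => ?_⟩
  have hs : 0 ≤ ∑ i, w i := Finset.sum_nonneg fun i _ => hw i
  have hU : |(Uᵀ * Matrix.diagonal w * U) i j| ≤ |a| * ∑ k, w k := by
    rw [mul_apply, Finset.mul_sum]
    refine (Finset.abs_sum_le_sum_abs _ _).trans (Finset.sum_le_sum fun k _ => ?_)
    have hk : |U k i * U k j| ≤ a := ha ⟨(k, i, j), rfl⟩
    rw [mul_diagonal, transpose_apply, mul_right_comm, abs_mul, abs_of_nonneg (hw k)]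
    exact mul_le_mul_of_nonneg_right (hk.trans (le_abs_self a)) (hw k)
  have hBij : |B⁻¹ i j| ≤ |c| := (hc ⟨(i, j), rfl⟩ : _ ≤ c).trans (le_abs_self c)
  calc |pswPrec U B w i j| ≤ |a| * ∑ k, w k + |c| :=
        (abs_add_le _ _).trans (add_le_add hU hBij)
    _ ≤ _ := by nlinarith [abs_nonneg a, mul_nonneg (abs_nonneg c) hs]

/-- Bound (25) in the proof of Theorem 4: the conditional Gaussian density `π(β | w, y)` of the
PS&W sampler is dominated by `C₁ (∑ᵢ wᵢ + 1)^{p/2} exp(−(1/2)βᵀB⁻¹β) exp(βᵀμ)`. -/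
theorem stmt_10 {n p : ℕ} (hn : 0 < n) (hp : 0 < p)
    (U : Matrix (Fin n) (Fin p) ℝ) (B : Matrix (Fin p) (Fin p) ℝ) (hB : B.PosDef)
    (b : Fin p → ℝ) (y : Fin n → ℝ) (hy : ∀ i, y i = 0 ∨ y i = 1) :
    ∃ C₁ > (0 : ℝ), ∀ w : Fin n → ℝ, (∀ i, 0 ≤ w i) → ∀ β : Fin p → ℝ,
      pswNormalDensity U B b y β w
        ≤ C₁ * (∑ i, w i + 1) ^ ((p : ℝ) / 2) *
            Real.exp (-(1/2) * (β ⬝ᵥ B⁻¹ *ᵥ β)) * Real.exp (β ⬝ᵥ pswMu U B b y) := by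
  obtain ⟨K, hK, hentry⟩ := exists_abs_pswPrec_apply_le U B
  refine ⟨(2 * Real.pi) ^ (-(p : ℝ) / 2) * (p.factorial * K ^ p) ^ ((1 : ℝ) / 2),
    by positivity, fun w hw β => ?_⟩
  have hP := pswPrec_posDef U hB hw
  have hs : 0 ≤ ∑ i, w i + 1 := add_nonneg (Finset.sum_nonneg fun i _ => hw i) zero_le_one
  have hdet : (pswPrec U B w).det ≤ p.factorial * K ^ p * (∑ i, w i + 1) ^ p := by
    have h := det_le (abv := AbsoluteValue.abs) (hentry w hw)
    simp only [Fintype.card_fin, nsmul_eq_mul, mul_pow, ← mul_assoc] at h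
    exact (le_abs_self _).trans h
  have hsqrt : (pswPrec U B w).det ^ ((1 : ℝ) / 2) ≤
      (p.factorial * K ^ p) ^ ((1 : ℝ) / 2) * (∑ i, w i + 1) ^ ((p : ℝ) / 2) := by
    refine (Real.rpow_le_rpow hP.det_pos.le hdet (by norm_num)).trans_eq ?_
    rw [Real.mul_rpow (by positivity) (by positivity), ← Real.rpow_natCast (∑ i, w i + 1) p,
      ← Real.rpow_mul hs, mul_one_div]
  rw [pswNormalDensity, mul_assoc _ (Real.exp _) (Real.exp _), ← Real.exp_add,
    mul_assoc ((2 * Real.pi) ^ (-(p : ℝ) / 2)) (_ ^ ((1 : ℝ) / 2)) (_ ^ ((p : ℝ) / 2))]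
  gcongr
  linarith [dotProduct_inv_mulVec_le_pswPrec U B hw β,
    hP.le_quadForm_sub_inv_mulVec β (pswMu U B b y)]
end

section
/- Let (𝒳, 𝒜, ν) and (𝒵, 𝒞, ζ) be σ-finite measure spaces, let f₁ : 𝒵 × 𝒳 → [0, ∞) and f₂ : 𝒳 × 𝒵 → [0, ∞) be measurable with ∫ f₂(x, z) dζ(z) = 1 for every x, let π : 𝒳 → (0, ∞) be measurable, set k(x, x′) = ∫ f₁(z, x′) f₂(x, z) dζ(z), and let m ≥ 2 and N ≥ 1 be integers. On a probability space, let (X₀,…,X_{m−1}) be a random vector whose law has density q with respect to ν^{⊗m}, and, conditionally on (X₀,…,X_{m−1}), let { Z_l^{(j)} : 1 ≤ l ≤ N, 0 ≤ j ≤ m−2 } be independent with Z_l^{(j)} having density f₂(X_j, ·) with respect to ζ (equivalently, the joint law of the X's and Z's has density q(x₀,…,x_{m−1}) ∏_{j=0}^{m−2} ∏_{l=1}^N f₂(x_j, z_l^{(j)})). For 0 ≤ j < j′ ≤ m−1 set k̂_N(X_j, X_{j′}) = (1/N) ∑_{l=1}^N f₁(Z_l^{(j)}, X_{j′}), and let Ĥ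 and H be the symmetric m × m random matrices with zero diagonal whose (j, j′) entries for j < j′ are (1/m) k̂_N(X_j, X_{j′})/π(X_{j′}) and (1/m) k(X_j, X_{j′})/π(X_{j′}) respectively. Let M = max_{0 ≤ j < j′ ≤ m−1} ∫_{𝒳} ∫_{𝒳} ∫_{𝒵} ( f₁(z, x′)/π(x′) )² f₂(x, z) q_{jj′}(x, x′) dζ(z) dν(x) dν(x′), where q_{jj′} is the joint density of (X_j, X_{j′}). Then for every ε > 0: P( ‖Ĥ − H‖_F > ε ) ≤ M / (N ε²), where ‖·‖_F denotes the Frobenius norm. -/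
open MeasureTheory
open scoped ENNReal

/-- The Lebesgue integral of a product of functions of independent coordinates. -/
theorem lintegral_pi_prod_eq_prod {E : Type*} [MeasurableSpace E] {n : ℕ}
    (μ : Fin n → Measure E) [∀ i, SigmaFinite (μ i)] {f : Fin n → E → ℝ≥0∞}
    (hf : ∀ i, Measurable (f i)) :
    ∫⁻ x, ∏ i, f i (x i) ∂(Measure.pi μ) = ∏ i, ∫⁻ x, f i x ∂(μ i) := by
  induction n with
  | zero => simp [lintegral_unique]
  | succ n ih =>
    have hmeas : Measurable fun x : Fin n → E => ∏ i, f (Fin.succ i) (x i) :=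
      Finset.measurable_prod _ fun i _ => (hf _).comp (measurable_pi_apply i)
    rw [← ((measurePreserving_piFinSuccAbove μ 0).symm).lintegral_comp_emb
      (MeasurableEquiv.measurableEmbedding _)]
    simp only [MeasurableEquiv.piFinSuccAbove_symm_apply, Fin.insertNthEquiv,
      Fin.prod_univ_succ, Fin.insertNth_zero, Equiv.coe_fn_mk, Fin.cons_succ, Fin.zero_succAbove,
      Fin.cons_zero, cast_eq]
    rw [lintegral_prod_mul (f := f 0) (hf 0).aemeasurable hmeas.aemeasurable,
      ih _ fun i => hf _]

/-- A product of measures with densities has the product density. -/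
theorem pi_withDensity_eq {E : Type*} [MeasurableSpace E] {n : ℕ}
    (μ : Fin n → Measure E) [∀ i, SigmaFinite (μ i)] {f : Fin n → E → ℝ≥0∞}
    (hf : ∀ i, Measurable (f i)) [∀ i, SigmaFinite ((μ i).withDensity (f i))] :
    Measure.pi (fun i => (μ i).withDensity (f i)) =
      (Measure.pi μ).withDensity fun x => ∏ i, f i (x i) := by
  classical
  refine Measure.pi_eq fun s hs => ?_
  rw [withDensity_apply _ (MeasurableSet.univ_pi hs),
    ← lintegral_indicator (MeasurableSet.univ_pi hs)]
  have h : (Set.univ.pi s).indicator (fun x => ∏ i, f i (x i)) =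
      fun x => ∏ i, (s i).indicator (f i) (x i) := by
    ext x
    by_cases hx : x ∈ Set.univ.pi s
    · rw [Set.indicator_of_mem hx]
      exact Finset.prod_congr rfl fun i _ => by
        rw [Set.indicator_of_mem (hx i (Set.mem_univ i))]
    · rw [Set.indicator_of_notMem hx]
      simp only [Set.mem_univ_pi, not_forall] at hx
      obtain ⟨i, hi⟩ := hx
      exact (Finset.prod_eq_zero (Finset.mem_univ i) (Set.indicator_of_notMem hi _)).symm
  rw [h, lintegral_pi_prod_eq_prod μ fun i => (hf i).indicator (hs i)]
  refine Finset.prod_congr rfl fun i _ => ?_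
  rw [lintegral_indicator (hs i), withDensity_apply _ (hs i)]

/-- Integration against a law under which, conditionally on the first coordinate, the entries of
a random array are independent: a function of the first coordinate and one row of the array. -/
theorem lintegral_withDensity_prod_pi_row {α Z : Type*} [MeasurableSpace α] [MeasurableSpace Z]
    (μ : Measure α) [SFinite μ] (ζ : Measure Z) [SigmaFinite ζ] {n N : ℕ}
    {a : α → ℝ≥0∞} (ha : Measurable a) {p : Fin n → α → Z → ℝ≥0∞}
    (hp : ∀ j, Measurable (Function.uncurry (p j)))
    (hp_one : ∀ j x, ∫⁻ z, p j x z ∂ζ = 1) (j : Fin n)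
    {F : α × (Fin N → Z) → ℝ≥0∞} (hF : Measurable F) :
    ∫⁻ y, F (y.1, y.2 j) ∂((μ.prod
        (Measure.pi fun _ : Fin n => Measure.pi fun _ : Fin N => ζ)).withDensity
          fun y => a y.1 * ∏ i, ∏ l, p i y.1 (y.2 i l)) =
      ∫⁻ x, a x * ∫⁻ w, F (x, w) ∂(Measure.pi fun _ : Fin N => ζ.withDensity (p j x)) ∂μ := by
  have hprod : Measurable fun y : α × (Fin n → Fin N → Z) => ∏ i, ∏ l, p i y.1 (y.2 i l) :=
    Finset.measurable_prod _ fun i _ => Finset.measurable_prod _ fun l _ =>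
      (hp i).comp (measurable_fst.prodMk (by fun_prop))
  have hFj : Measurable fun y : α × (Fin n → Fin N → Z) => F (y.1, y.2 j) :=
    hF.comp (by fun_prop)
  have hdens : Measurable fun y : α × (Fin n → Fin N → Z) =>
      a y.1 * ∏ i, ∏ l, p i y.1 (y.2 i l) := (ha.comp measurable_fst).mul hprod
  rw [lintegral_withDensity_eq_lintegral_mul _ hdens hFj,
    lintegral_prod _ (hdens.mul hFj).aemeasurable]
  refine lintegral_congr fun x => ?_
  have hpx : ∀ i, Measurable (p i x) := fun i => (hp i).comp measurable_prodMk_left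
  have : ∀ i, IsProbabilityMeasure (ζ.withDensity (p i x)) := fun i =>
    ⟨by rw [withDensity_apply _ MeasurableSet.univ, Measure.restrict_univ, hp_one]⟩
  have hrow : ∀ i, Measure.pi (fun _ : Fin N => ζ.withDensity (p i x)) =
      (Measure.pi fun _ : Fin N => ζ).withDensity fun w => ∏ l, p i x (w l) :=
    fun i => pi_withDensity_eq (fun _ => ζ) fun _ => hpx i
  have : ∀ i, IsProbabilityMeasure
      ((Measure.pi fun _ : Fin N => ζ).withDensity fun w => ∏ l, p i x (w l)) :=
    fun i => by rw [← hrow]; infer_instance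
  have hrowmeas : ∀ i, Measurable fun w : Fin N → Z => ∏ l, p i x (w l) := fun i =>
    Finset.measurable_prod _ fun l _ => (hpx i).comp (measurable_pi_apply l)
  have harray := pi_withDensity_eq (fun _ : Fin n => Measure.pi fun _ : Fin N => ζ) hrowmeas
  have hFx : Measurable fun w => F (x, w) := hF.comp measurable_prodMk_left
  have heval := (measurePreserving_eval (fun i : Fin n =>
    (Measure.pi fun _ : Fin N => ζ).withDensity fun w => ∏ l, p i x (w l)) j).lintegral_comp hFx
  have hprodx := hprod.comp (measurable_prodMk_left (x := x))
  have hFjx := hFj.comp (measurable_prodMk_left (x := x))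
  rw [hrow, ← heval, harray]
  erw [lintegral_withDensity_eq_lintegral_mul _ hprodx hFjx]
  rw [← lintegral_const_mul _ (hprodx.mul hFjx)]
  exact lintegral_congr fun y => by simp [mul_assoc]

/-- The mean squared error of the Monte Carlo average of `N` independent samples is at most the
second moment divided by `N`. -/
theorem lintegral_pi_sq_average_sub_integral_le {Z : Type*} [MeasurableSpace Z] (μ : Measure Z)
    [IsProbabilityMeasure μ] {N : ℕ} (hN : 1 ≤ N) {g : Z → ℝ} (hg : Measurable g) :
    ∫⁻ w, ENNReal.ofReal (((1 / (N : ℝ)) * ∑ l, g (w l) - ∫ z, g z ∂μ) ^ 2)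
        ∂(Measure.pi fun _ : Fin N => μ) ≤
      (∫⁻ z, ENNReal.ofReal (g z ^ 2) ∂μ) / N := by
  have hN0 : (N : ℝ) ≠ 0 := by positivity
  by_cases htop : ∫⁻ z, ENNReal.ofReal (g z ^ 2) ∂μ = ⊤
  · simp [htop, ENNReal.top_div_of_ne_top]
  have hint : Integrable (fun z => g z ^ 2) μ :=
    ⟨by fun_prop, (hasFiniteIntegral_iff_ofReal (.of_forall fun z => sq_nonneg _)).2
      (lt_top_iff_ne_top.2 htop)⟩
  have hL2 : MemLp g 2 μ := (memLp_two_iff_integrable_sq hg.aestronglyMeasurable).2 hint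
  have hL2' : ∀ l : Fin N, MemLp (fun w : Fin N → Z => g (w l)) 2 (Measure.pi fun _ => μ) :=
    fun l => hL2.comp_measurePreserving (measurePreserving_eval _ l)
  have hmean : ∫ w, (1 / (N : ℝ)) * ∑ l, g (w l) ∂(Measure.pi fun _ : Fin N => μ) =
      ∫ z, g z ∂μ := by
    rw [integral_const_mul, integral_finsetSum _ fun l _ => (hL2' l).integrable one_le_two]
    simp_rw [integral_comp_eval (μ := fun _ : Fin N => μ) hg.aestronglyMeasurable]
    simp [hN0]
  have hvar := ProbabilityTheory.variance_sum_pi (μ := fun _ : Fin N => μ) (X := fun _ => g)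
    fun _ => hL2
  have hsum : MemLp (fun w : Fin N → Z => (1 / (N : ℝ)) * ∑ l, g (w l)) 2
      (Measure.pi fun _ => μ) :=
    (memLp_finsetSum _ fun l _ => hL2' l).const_mul _
  rw [← hmean, ← ProbabilityTheory.evariance_eq_lintegral_ofReal,
    ← ProbabilityTheory.ofReal_variance hsum, ProbabilityTheory.variance_const_mul,
    ← ofReal_integral_eq_lintegral_ofReal hint (.of_forall fun z => sq_nonneg _),
    ← ENNReal.ofReal_natCast, ← ENNReal.ofReal_div_of_pos (by positivity)]
  refine ENNReal.ofReal_le_ofReal ?_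
  have hle := ProbabilityTheory.variance_le_expectation_sq hg.aestronglyMeasurable (μ := μ)
  have hsumfun : (∑ i : Fin N, fun ω : Fin N → Z => g (ω i)) = fun w => ∑ l, g (w l) := by
    ext; simp
  rw [hsumfun] at hvar
  rw [hvar, Finset.sum_const, Finset.card_univ, Fintype.card_fin, nsmul_eq_mul]
  calc _ = ProbabilityTheory.variance g μ / N := by field_simp
    _ ≤ _ := by gcongr; exact hle



/-- The core probabilistic estimate in the proof of Theorem 2: the probability that the
Frobenius distance between the Monte Carlo random matrix `Ĥ` of the MCRMA algorithm and the
exact random matrix `H` of the RMA algorithm exceeds `ε` is at most `M/(Nε²)`, where `M` is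
the maximum over pairs `j < j'` of the integrated second moments. The joint law of the
`X`'s and `Z`'s has density `q(x₀,…,x_{m−1}) ∏_{j≤m−2} ∏_{l<N} f₂(x_j, z_l^{(j)})`. -/
theorem stmt_17 {X Z Ω : Type*} [MeasurableSpace X] [MeasurableSpace Z] [MeasurableSpace Ω]
    (P : Measure Ω) [IsProbabilityMeasure P]
    (ν : Measure X) (ζ : Measure Z) [SigmaFinite ν] [SigmaFinite ζ]
    (f₁ : Z → X → ℝ) (f₂ : X → Z → ℝ)
    (hf₁meas : Measurable (Function.uncurry f₁)) (hf₂meas : Measurable (Function.uncurry f₂))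
    (hf₁nonneg : ∀ z x, 0 ≤ f₁ z x) (hf₂nonneg : ∀ x z, 0 ≤ f₂ x z)
    (hf₂prob : ∀ x, ∫⁻ z, ENNReal.ofReal (f₂ x z) ∂ζ = 1)
    (π : X → ℝ) (hπmeas : Measurable π) (hπpos : ∀ x, 0 < π x)
    (k : X → X → ℝ) (hk : ∀ x x', k x x' = ∫ z, f₁ z x' * f₂ x z ∂ζ)
    (m N : ℕ) (hm : 2 ≤ m) (hN : 1 ≤ N)
    (q : (Fin m → X) → ℝ) (hqmeas : Measurable q) (hqnonneg : ∀ x, 0 ≤ q x)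
    (hqprob : ∫⁻ x, ENNReal.ofReal (q x) ∂(Measure.pi fun _ : Fin m => ν) = 1)
    (Xv : Ω → Fin m → X) (hXmeas : Measurable Xv)
    (Zv : Ω → Fin (m - 1) → Fin N → Z) (hZmeas : Measurable Zv)
    (hJointLaw : Measure.map (fun ω => (Xv ω, Zv ω)) P
      = ((Measure.pi fun _ : Fin m => ν).prod
          (Measure.pi fun _ : Fin (m - 1) => Measure.pi fun _ : Fin N => ζ)).withDensity
          (fun xz => ENNReal.ofReal (q xz.1) *
            ∏ j : Fin (m - 1), ∏ l : Fin N,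
              ENNReal.ofReal (f₂ (xz.1 (Fin.castLE (Nat.sub_le m 1) j)) (xz.2 j l))))
    (qm : Fin m → Fin m → X → X → ℝ)
    (hqm_meas : ∀ j j', Measurable (Function.uncurry (qm j j')))
    (hqm_nonneg : ∀ j j' x x', 0 ≤ qm j j' x x')
    (hqm_law : ∀ j j' : Fin m, (j : ℕ) < (j' : ℕ) →
      Measure.map (fun ω => (Xv ω j, Xv ω j')) P
        = (ν.prod ν).withDensity fun xx => ENNReal.ofReal (qm j j' xx.1 xx.2))
    (Hhat Hmat : Ω → Fin m → Fin m → ℝ)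
    (hHhat_diag : ∀ ω j, Hhat ω j j = 0)
    (hHhat_symm : ∀ ω j j', Hhat ω j j' = Hhat ω j' j)
    (hHhat_entry : ∀ ω (j j' : Fin m), ∀ h : (j : ℕ) < (j' : ℕ),
      Hhat ω j j' = (1 / (m : ℝ)) *
        ((1 / (N : ℝ)) * ∑ l : Fin N,
          f₁ (Zv ω ⟨(j : ℕ), by have := j'.isLt; omega⟩ l) (Xv ω j')) / π (Xv ω j'))
    (hH_diag : ∀ ω j, Hmat ω j j = 0)
    (hH_symm : ∀ ω j j', Hmat ω j j' = Hmat ω j' j)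
    (hH_entry : ∀ ω (j j' : Fin m), (j : ℕ) < (j' : ℕ) →
      Hmat ω j j' = (1 / (m : ℝ)) * k (Xv ω j) (Xv ω j') / π (Xv ω j')) :
    ∀ ε : ℝ, 0 < ε →
      P {ω | ε < Real.sqrt (∑ j : Fin m, ∑ j' : Fin m, (Hhat ω j j' - Hmat ω j j') ^ 2)}
        ≤ (⨆ j : Fin m, ⨆ j' : Fin m, ⨆ _ : (j : ℕ) < (j' : ℕ),
            ∫⁻ x', (∫⁻ x, (∫⁻ z,
              ENNReal.ofReal ((f₁ z x' / π x') ^ 2 * f₂ x z * qm j j' x x') ∂ζ) ∂ν) ∂ν)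
          / ((N : ℝ≥0∞) * ENNReal.ofReal (ε ^ 2)) := by
  intro ε hε
  have hkmeas : Measurable (Function.uncurry k) := by
    have h : Measurable fun y : (X × X) × Z => f₁ y.2 y.1.2 * f₂ y.1.1 y.2 :=
      (hf₁meas.comp (measurable_snd.prodMk (measurable_snd.comp measurable_fst))).mul
        (hf₂meas.comp ((measurable_fst.comp measurable_fst).prodMk measurable_snd))
    convert (h.stronglyMeasurable.integral_prod_right' (ν := ζ)).measurable using 1
    ext y
    exact hk y.1 y.2
  have hf₂x : ∀ x, Measurable fun z => ENNReal.ofReal (f₂ x z) := fun x =>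
    (hf₂meas.comp measurable_prodMk_left).ennreal_ofReal
  have hprob : ∀ x, IsProbabilityMeasure (ζ.withDensity fun z => ENNReal.ofReal (f₂ x z)) :=
    fun x => ⟨by rw [withDensity_apply _ MeasurableSet.univ, Measure.restrict_univ, hf₂prob]⟩
  have hlaw : ∀ (j : Fin (m - 1)) (F : (Fin m → X) × (Fin N → Z) → ℝ≥0∞), Measurable F →
      ∫⁻ ω, F (Xv ω, Zv ω j) ∂P = ∫⁻ x, ENNReal.ofReal (q x) * ∫⁻ w, F (x, w)
        ∂(Measure.pi fun _ : Fin N => ζ.withDensity fun z =>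
          ENNReal.ofReal (f₂ (x (Fin.castLE (Nat.sub_le m 1) j)) z))
        ∂(Measure.pi fun _ : Fin m => ν) := by
    intro j F hF
    rw [← lintegral_withDensity_prod_pi_row (Measure.pi fun _ : Fin m => ν) ζ
      hqmeas.ennreal_ofReal
      (p := fun j x z => ENNReal.ofReal (f₂ (x (Fin.castLE (Nat.sub_le m 1) j)) z))
      (fun j => (hf₂meas.comp (f := fun y : (Fin m → X) × Z =>
        (y.1 (Fin.castLE (Nat.sub_le m 1) j), y.2)) (by fun_prop)).ennreal_ofReal)
      (fun j x => hf₂prob _) j hF, ← hJointLaw]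
    exact (lintegral_map (hF.comp (f := fun y : (Fin m → X) × (Fin (m - 1) → Fin N → Z) =>
      (y.1, y.2 j)) (by fun_prop)) (hXmeas.prodMk hZmeas)).symm
  set M := ⨆ j : Fin m, ⨆ j' : Fin m, ⨆ _ : (j : ℕ) < (j' : ℕ),
    ∫⁻ x', (∫⁻ x, (∫⁻ z,
      ENNReal.ofReal ((f₁ z x' / π x') ^ 2 * f₂ x z * qm j j' x x') ∂ζ) ∂ν) ∂ν
  have hpair : ∀ j j' : Fin m, (j : ℕ) < (j' : ℕ) →
      Measurable (fun ω => ENNReal.ofReal ((Hhat ω j j' - Hmat ω j j') ^ 2)) ∧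
      ∫⁻ ω, ENNReal.ofReal ((Hhat ω j j' - Hmat ω j j') ^ 2) ∂P ≤
        ENNReal.ofReal ((1 / (m : ℝ)) ^ 2) * (M / N) := by
    intro j j' hjj'
    obtain ⟨i, hi⟩ : ∃ i : Fin (m - 1), i = ⟨(j : ℕ), by have := j'.isLt; omega⟩ := ⟨_, rfl⟩
    have hij : Fin.castLE (Nat.sub_le m 1) i = j := by subst hi; rfl
    have hgmeas : Measurable fun y : X × Z => f₁ y.2 y.1 / π y.1 :=
      (hf₁meas.comp measurable_swap).div (hπmeas.comp measurable_fst)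
    let F : (Fin m → X) × (Fin N → Z) → ℝ≥0∞ := fun y => ENNReal.ofReal
      (((1 / (N : ℝ)) * ∑ l, f₁ (y.2 l) (y.1 j') / π (y.1 j') -
        k (y.1 j) (y.1 j') / π (y.1 j')) ^ 2)
    have hF : Measurable F := by
      have h1 : ∀ l : Fin N, Measurable fun y : (Fin m → X) × (Fin N → Z) =>
          f₁ (y.2 l) (y.1 j') / π (y.1 j') := fun l =>
        hgmeas.comp (f := fun y : (Fin m → X) × (Fin N → Z) => (y.1 j', y.2 l)) (by fun_prop)
      have h2 : Measurable fun y : (Fin m → X) × (Fin N → Z) => k (y.1 j) (y.1 j') :=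
        hkmeas.comp (f := fun y : (Fin m → X) × (Fin N → Z) => (y.1 j, y.1 j')) (by fun_prop)
      have h3 : Measurable fun y : (Fin m → X) × (Fin N → Z) => π (y.1 j') :=
        hπmeas.comp (by fun_prop)
      exact ((((Finset.measurable_sum _ fun l _ => h1 l).const_mul _).sub
        (h2.div h3)).pow_const 2).ennreal_ofReal
    have hDF : ∀ ω, ENNReal.ofReal ((Hhat ω j j' - Hmat ω j j') ^ 2) =
        ENNReal.ofReal ((1 / (m : ℝ)) ^ 2) * F (Xv ω, Zv ω i) := by
      intro ω
      rw [← ENNReal.ofReal_mul (by positivity), ← mul_pow, hHhat_entry ω j j' hjj',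
        hH_entry ω j j' hjj', ← hi, ← Finset.sum_div]
      ring_nf
    simp_rw [hDF]
    have hFω : Measurable fun ω => F (Xv ω, Zv ω i) := hF.comp (by fun_prop)
    refine ⟨hFω.const_mul _, ?_⟩
    rw [lintegral_const_mul _ hFω]
    gcongr
    let G : X × X → ℝ≥0∞ := fun y =>
      ∫⁻ z, ENNReal.ofReal (f₂ y.1 z) * ENNReal.ofReal ((f₁ z y.2 / π y.2) ^ 2) ∂ζ
    have hGint : Measurable fun y : (X × X) × Z =>
        ENNReal.ofReal (f₂ y.1.1 y.2) * ENNReal.ofReal ((f₁ y.2 y.1.2 / π y.1.2) ^ 2) :=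
      (hf₂meas.comp (f := fun y : (X × X) × Z => (y.1.1, y.2)) (by fun_prop)).ennreal_ofReal.mul
        ((hgmeas.comp (f := fun y : (X × X) × Z => (y.1.2, y.2))
          (by fun_prop)).pow_const 2).ennreal_ofReal
    have hG : Measurable G := hGint.lintegral_prod_right'
    have hinner : ∀ x : Fin m → X, ∫⁻ w, F (x, w)
        ∂(Measure.pi fun _ : Fin N => ζ.withDensity fun z => ENNReal.ofReal (f₂ (x j) z)) ≤
          G (x j, x j') / N := by
      intro x
      have hgx : Measurable fun z => f₁ z (x j') / π (x j') := hgmeas.comp measurable_prodMk_left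
      have hmean : ∫ z, f₁ z (x j') / π (x j')
          ∂(ζ.withDensity fun z => ENNReal.ofReal (f₂ (x j) z)) =
            k (x j) (x j') / π (x j') := by
        rw [integral_withDensity_eq_integral_toReal_smul (hf₂x _) (by simp), hk,
          ← integral_div]
        refine integral_congr_ae (.of_forall fun z => ?_)
        simp only [ENNReal.toReal_ofReal (hf₂nonneg _ _), smul_eq_mul]
        ring
      have h := lintegral_pi_sq_average_sub_integral_le
        (ζ.withDensity fun z => ENNReal.ofReal (f₂ (x j) z)) hN hgx
      rw [hmean, lintegral_withDensity_eq_lintegral_mul _ (hf₂x _)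
        (hgx.pow_const 2).ennreal_ofReal] at h
      exact h
    have hGlaw : ∫⁻ ω, G (Xv ω j, Xv ω j') ∂P = ∫⁻ x, ENNReal.ofReal (q x) * G (x j, x j')
        ∂(Measure.pi fun _ : Fin m => ν) := by
      rw [hlaw i (fun y => G (y.1 j, y.1 j')) (hG.comp (by fun_prop))]
      simp
    have hGM : ∫⁻ ω, G (Xv ω j, Xv ω j') ∂P ≤ M := by
      have hqm : Measurable fun xx : X × X => ENNReal.ofReal (qm j j' xx.1 xx.2) :=
        (hqm_meas j j').ennreal_ofReal
      have hXjj' : Measurable fun ω => (Xv ω j, Xv ω j') := by fun_prop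
      rw [← lintegral_map hG hXjj', hqm_law j j' hjj',
        lintegral_withDensity_eq_lintegral_mul _ hqm hG,
        lintegral_prod_symm' _ (hqm.mul hG)]
      refine le_of_eq_of_le ?_ (le_iSup_of_le j (le_iSup_of_le j' (le_iSup_of_le hjj' le_rfl)))
      refine lintegral_congr fun x' => lintegral_congr fun x => ?_
      simp only [Pi.mul_apply, G]
      refine (lintegral_const_mul _
        (hGint.comp (measurable_prodMk_left (x := (x, x'))))).symm.trans ?_
      refine lintegral_congr fun z => ?_
      simp only [Function.comp_apply]
      rw [← ENNReal.ofReal_mul (hf₂nonneg _ _), ← ENNReal.ofReal_mul (hqm_nonneg _ _ _ _)]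
      ring_nf
    rw [hlaw i F hF, hij]
    calc _ ≤ ∫⁻ x, ENNReal.ofReal (q x) * (G (x j, x j') / N)
          ∂(Measure.pi fun _ : Fin m => ν) := by gcongr with x; exact hinner x
      _ = (∫⁻ ω, G (Xv ω j, Xv ω j') ∂P) / N := by
        simp_rw [hGlaw, div_eq_mul_inv, ← mul_assoc]
        exact lintegral_mul_const _ (hqmeas.ennreal_ofReal.mul
          (hG.comp (f := fun x : Fin m → X => (x j, x j')) (by fun_prop)))
      _ ≤ M / N := by gcongr
  have hall : ∀ j j' : Fin m,
      Measurable (fun ω => ENNReal.ofReal ((Hhat ω j j' - Hmat ω j j') ^ 2)) ∧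
      ∫⁻ ω, ENNReal.ofReal ((Hhat ω j j' - Hmat ω j j') ^ 2) ∂P ≤
        ENNReal.ofReal ((1 / (m : ℝ)) ^ 2) * (M / N) := by
    intro j j'
    rcases lt_trichotomy (j : ℕ) j' with h | h | h
    · exact hpair j j' h
    · obtain rfl := Fin.ext h
      simp [hHhat_diag, hH_diag]
    · simp_rw [hHhat_symm _ j j', hH_symm _ j j']
      exact hpair j' j h
  have hε2 : ENNReal.ofReal (ε ^ 2) ≠ 0 := by simp [hε.ne']
  have hsum : ∀ ω, ENNReal.ofReal (∑ j, ∑ j', (Hhat ω j j' - Hmat ω j j') ^ 2) =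
      ∑ j, ∑ j', ENNReal.ofReal ((Hhat ω j j' - Hmat ω j j') ^ 2) := fun ω => by
    rw [ENNReal.ofReal_sum_of_nonneg fun j _ => Finset.sum_nonneg fun j' _ => sq_nonneg _]
    exact Finset.sum_congr rfl fun j _ => ENNReal.ofReal_sum_of_nonneg fun j' _ => sq_nonneg _
  have hsum_meas : Measurable fun ω =>
      ∑ j, ∑ j', ENNReal.ofReal ((Hhat ω j j' - Hmat ω j j') ^ 2) :=
    Finset.measurable_sum _ fun j _ => Finset.measurable_sum _ fun j' _ => (hall j j').1
  have hbound : ∫⁻ ω, ∑ j, ∑ j', ENNReal.ofReal ((Hhat ω j j' - Hmat ω j j') ^ 2) ∂P ≤ M / N := by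
    rw [lintegral_finsetSum _ fun j _ => Finset.measurable_sum _ fun j' _ => (hall j j').1]
    simp_rw [fun j => lintegral_finsetSum (μ := P) Finset.univ fun j' _ => (hall j j').1]
    calc _ ≤ ∑ _j : Fin m, ∑ _j' : Fin m, ENNReal.ofReal ((1 / (m : ℝ)) ^ 2) * (M / N) := by
          gcongr with j _ j' _
          exact (hall j j').2
      _ = ENNReal.ofReal ((m : ℝ) * (m * (1 / (m : ℝ)) ^ 2)) * (M / N) := by
          rw [ENNReal.ofReal_mul (by positivity), ENNReal.ofReal_mul (by positivity)]
          simp [mul_assoc]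
      _ = M / N := by
          have hm0 : (m : ℝ) ≠ 0 := by positivity
          rw [show (m : ℝ) * (m * (1 / (m : ℝ)) ^ 2) = 1 by field_simp]
          simp
  calc _ ≤ P {ω | ENNReal.ofReal (ε ^ 2) ≤
        ∑ j, ∑ j', ENNReal.ofReal ((Hhat ω j j' - Hmat ω j j') ^ 2)} := by
        refine measure_mono fun ω hω => ?_
        simp only [Set.mem_ofPred_eq] at hω ⊢
        rw [← hsum]
        exact ENNReal.ofReal_le_ofReal ((Real.lt_sqrt hε.le).1 hω).le
    _ ≤ (M / N) / ENNReal.ofReal (ε ^ 2) :=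
        (meas_ge_le_lintegral_div hsum_meas.aemeasurable hε2 ENNReal.ofReal_ne_top).trans
          (by gcongr)
    _ = M / (N * ENNReal.ofReal (ε ^ 2)) := by
        rw [div_eq_mul_inv, div_eq_mul_inv, div_eq_mul_inv,
          ENNReal.mul_inv (.inr ENNReal.ofReal_ne_top) (.inr hε2), mul_assoc]
end
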